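/- Let d≥3 and let V be a real Γ-periodic potential on ℤ^d. If V and the zero potential are Fermi isospectral, i.e., F_{λ_0}(V)=F_{λ_0}(0) for some λ_0∈ℂ, then V(n)=0 for all n∈ℤ^d. -/

import Mathlib

noncomputable section

/-- The discrete Laplacian on `ℤ^d`: `(Δu)(n) = Σ_{‖n'-n‖₁ = 1} u(n')`. -/
def discLap {d : ℕ} (u : (Fin d → ℤ) → ℂ) (n : Fin d → ℤ) : ℂ :=
  ∑ j : Fin d, (u (Function.update n j (n j + 1)) + u (Function.update n j (n j - 1)))

/-- Reduction of an integer modulo `q`, as an element of `Fin q`. -/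
def fem (q : ℕ+) (a : ℤ) : Fin (q : ℕ) :=
  ⟨(a % ((q : ℕ) : ℤ)).toNat, by
    have hq : (0:ℤ) < ((q : ℕ) : ℤ) := by exact_mod_cast q.pos
    have h1 : 0 ≤ a % ((q : ℕ) : ℤ) := Int.emod_nonneg a (ne_of_gt hq)
    have h2 : a % ((q : ℕ) : ℤ) < ((q : ℕ) : ℤ) := Int.emod_lt_of_pos a hq
    omega⟩

/-- Extension of a function on the fundamental domain `W` to `ℤ^d` using the
Floquet boundary conditions `u(n + qⱼ eⱼ) = zⱼ u(n)`. -/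
def extendBC {d : ℕ} (q : Fin d → ℕ+) (z : Fin d → ℂ)
    (u : (∀ j, Fin ((q j : ℕ))) → ℂ) : (Fin d → ℤ) → ℂ :=
  fun n => (∏ j, z j ^ (n j / ((q j : ℕ) : ℤ))) * u (fun j => fem (q j) (n j))

/-- The matrix `D_V(z)` of the Floquet reduction of `-Δ + V` to the fundamental domain. -/
def DVmat {d : ℕ} (q : Fin d → ℕ+) (V : (Fin d → ℤ) → ℂ) (z : Fin d → ℂ) :
    Matrix (∀ j, Fin ((q j : ℕ))) (∀ j, Fin ((q j : ℕ))) ℂ :=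
  fun n n' =>
    -(discLap (extendBC q z (Pi.single n' 1)) (fun j => ((n j : ℕ) : ℤ)))
      + V (fun j => ((n j : ℕ) : ℤ)) * (if n = n' then 1 else 0)

/-- `𝒫_V(z, λ) = det(D_V(z) - λ I)`. -/
def scriptP {d : ℕ} (q : Fin d → ℕ+) (V : (Fin d → ℤ) → ℂ) (z : Fin d → ℂ)
    (lam : ℂ) : ℂ :=
  Matrix.det (DVmat q V z - lam • (1 : Matrix (∀ j, Fin ((q j : ℕ))) (∀ j, Fin ((q j : ℕ))) ℂ))

/-- `Γ`-periodicity for a complex-valued function on `ℤ^d`. -/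
def IsPeriodic {d : ℕ} (q : Fin d → ℕ+) (V : (Fin d → ℤ) → ℂ) : Prop :=
  ∀ (n : Fin d → ℤ) (j : Fin d), V (Function.update n j (n j + ((q j : ℕ) : ℤ))) = V n

/-- `Γ`-periodicity for a real-valued function on `ℤ^d`. -/
def IsPeriodicR {d : ℕ} (q : Fin d → ℕ+) (V : (Fin d → ℤ) → ℝ) : Prop :=
  ∀ (n : Fin d → ℤ) (j : Fin d), V (Function.update n j (n j + ((q j : ℕ) : ℤ))) = V n

/-- `ρ_m = e^{2πi m / q}`. -/
def rho (q : ℕ+) (m : ℕ) : ℂ :=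
  Complex.exp (2 * (Real.pi : ℂ) * Complex.I * (m : ℂ) / ((q : ℕ) : ℂ))

/-- The discrete Fourier transform `V̂(l)` of a periodic potential. -/
def dft {d : ℕ} (q : Fin d → ℕ+) (V : (Fin d → ℤ) → ℂ) (l : Fin d → ℤ) : ℂ :=
  (1 / ((∏ j, (q j : ℕ) : ℕ) : ℂ)) * ∑ n : (∀ j, Fin ((q j : ℕ))),
    V (fun j => ((n j : ℕ) : ℤ)) *
      Complex.exp (-(2 * (Real.pi : ℂ) * Complex.I) * ∑ j, (l j : ℂ) * ((n j : ℕ) : ℂ) / ((q j : ℕ) : ℂ))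

/-- The diagonal matrix `A(z)` with entries `-Σⱼ (ρʲ_{nⱼ} zⱼ + 1/(ρʲ_{nⱼ} zⱼ))`. -/
def Amat {d : ℕ} (q : Fin d → ℕ+) (z : Fin d → ℂ) :
    Matrix (∀ j, Fin ((q j : ℕ))) (∀ j, Fin ((q j : ℕ))) ℂ :=
  Matrix.diagonal fun n => -(∑ j, (rho (q j) (n j) * z j + (rho (q j) (n j) * z j)⁻¹))

/-- The matrix `B_V` with entries `V̂(n - n')`. -/
def Bmat {d : ℕ} (q : Fin d → ℕ+) (V : (Fin d → ℤ) → ℂ) :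
    Matrix (∀ j, Fin ((q j : ℕ))) (∀ j, Fin ((q j : ℕ))) ℂ :=
  fun n n' => dft q V (fun j => ((n j : ℕ) : ℤ) - ((n' j : ℕ) : ℤ))

/-- The average `[V]` of a periodic potential. -/
def avgPot {d : ℕ} (q : Fin d → ℕ+) (V : (Fin d → ℤ) → ℂ) : ℂ :=
  (1 / ((∏ j, (q j : ℕ) : ℕ) : ℂ)) * ∑ n : (∀ j, Fin ((q j : ℕ))), V (fun j => ((n j : ℕ) : ℤ))

/-- The Fermi variety `F_λ(V)`. -/
def FermiVariety {d : ℕ} (q : Fin d → ℕ+) (V : (Fin d → ℤ) → ℂ) (lam : ℂ) :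
    Set (Fin d → ℂ) :=
  {k | ∃ u : (Fin d → ℤ) → ℂ, u ≠ 0 ∧
    (∀ n, -(discLap u n) + V n * u n = lam * u n) ∧
    (∀ (n : Fin d → ℤ) (j : Fin d),
      u (Function.update n j (n j + ((q j : ℕ) : ℤ)))
        = Complex.exp (2 * (Real.pi : ℂ) * Complex.I * k j) * u n)}

/-- Floquet isospectrality of two real periodic potentials. -/
def FloquetIso {d : ℕ} (q : Fin d → ℕ+) (V Y : (Fin d → ℤ) → ℝ) : Prop :=
  ∀ k : Fin d → ℝ,
    spectrum ℂ (DVmat q (fun n => ((V n : ℝ) : ℂ))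
        (fun j => Complex.exp (2 * (Real.pi : ℂ) * Complex.I * (k j : ℂ))))
      = spectrum ℂ (DVmat q (fun n => ((Y n : ℝ) : ℂ))
        (fun j => Complex.exp (2 * (Real.pi : ℂ) * Complex.I * (k j : ℂ))))

/-- A function on `(ℂ^*)^d` given by a Laurent polynomial. -/
def IsLaurent {d : ℕ} (f : (Fin d → ℂ) → ℂ) : Prop :=
  ∃ c : (Fin d → ℤ) →₀ ℂ, ∀ z : Fin d → ℂ, (∀ j, z j ≠ 0) →
    f z = c.sum fun a C => C * ∏ j, z j ^ a j

/-- A Laurent monomial `C z₁^{a₁} ⋯ z_d^{a_d}` with `C ≠ 0`. -/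
def IsMonomial {d : ℕ} (f : (Fin d → ℂ) → ℂ) : Prop :=
  ∃ (C : ℂ) (a : Fin d → ℤ), C ≠ 0 ∧ ∀ z : Fin d → ℂ, (∀ j, z j ≠ 0) →
    f z = C * ∏ j, z j ^ a j

/-- Irreducibility of a Laurent polynomial: no factorization into two non-monomial
Laurent polynomials. -/
def LaurentIrreducible {d : ℕ} (h : (Fin d → ℂ) → ℂ) : Prop :=
  ¬ ∃ f g : (Fin d → ℂ) → ℂ, IsLaurent f ∧ IsLaurent g ∧
      ¬ IsMonomial f ∧ ¬ IsMonomial g ∧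
      ∀ z : Fin d → ℂ, (∀ j, z j ≠ 0) → h z = f z * g z

section Perturbation

open Filter Topology

/-- If the diagonal entries `E t m`, `m ≠ o`, grow at least like `s t` while `E t o = 0`, then
solutions of `E a = B a` exist for all `t` only if the first two terms of the expansion of the
Schur complement at `o` vanish. -/
theorem schur_expansion_eq_zero {ι α : Type*} [Fintype ι] [DecidableEq ι] {l : Filter α} [l.NeBot]
    (B : ι → ι → ℂ) (o : ι) (E : α → ι → ℂ) (s : α → ℂ) (β : ι → ℂ)
    (hs : Tendsto (fun t => (s t)⁻¹) l (𝓝 0)) (hs0 : ∀ᶠ t in l, s t ≠ 0)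
    (hEo : ∀ t, E t o = 0) (hE : ∀ m, m ≠ o → ∀ᶠ t in l, E t m ≠ 0)
    (hβ : ∀ m, m ≠ o → Tendsto (fun t => s t / E t m) l (𝓝 (β m)))
    (hker : ∀ t, ∃ a : ι → ℂ, a ≠ 0 ∧ ∀ m, E t m * a m = ∑ k, B m k * a k) :
    B o o = 0 ∧ ∑ m ∈ Finset.univ.erase o, B o m * B m o * β m = 0 := by
  have hinv : ∀ m, m ≠ o → Tendsto (fun t => (E t m)⁻¹) l (𝓝 0) := by
    intro m hm
    have h := hs.mul (hβ m hm)
    rw [zero_mul] at h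
    refine h.congr' ?_
    filter_upwards [hs0] with t ht
    field_simp
  have hsmall : ∀ᶠ t in l, ∀ m, m ≠ o →
      E t m ≠ 0 ∧ ‖(E t m)⁻¹‖ * ∑ k, ‖B m k‖ < 1 := by
    rw [eventually_all]
    intro m
    by_cases hm : m = o
    · simp [hm]
    have h := (hinv m hm).norm.mul_const (∑ k, ‖B m k‖)
    rw [norm_zero, zero_mul] at h
    filter_upwards [hE m hm, h.eventually_lt_const one_pos] with t h1 h2 _
    exact ⟨h1, h2⟩
  have hnormal : ∀ᶠ t in l, ∃ a : ι → ℂ, a o = 1 ∧ (∀ m, ‖a m‖ ≤ 1) ∧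
      ∀ m, E t m * a m = ∑ k, B m k * a k := by
    filter_upwards [hsmall] with t ht
    obtain ⟨a, ha0, ha⟩ := hker t
    obtain ⟨M, -, hM⟩ := Finset.exists_max_image Finset.univ (fun m => ‖a m‖) ⟨o, Finset.mem_univ o⟩
    have hMpos : 0 < ‖a M‖ := by
      obtain ⟨m, hm⟩ := Function.ne_iff.mp ha0
      exact (norm_pos_iff.mpr hm).trans_le (hM m (Finset.mem_univ m))
    have hMo : M = o := by
      by_contra hne
      obtain ⟨h1, h2⟩ := ht M hne
      have h3 : a M = (E t M)⁻¹ * ∑ k, B M k * a k := by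
        rw [← ha M, inv_mul_cancel_left₀ h1]
      have h4 : ‖∑ k, B M k * a k‖ ≤ (∑ k, ‖B M k‖) * ‖a M‖ := by
        rw [Finset.sum_mul]
        refine norm_sum_le_of_le _ fun k hk => ?_
        rw [norm_mul]
        exact mul_le_mul_of_nonneg_left (hM k hk) (norm_nonneg _)
      have h5 : ‖a M‖ ≤ ‖(E t M)⁻¹‖ * (∑ k, ‖B M k‖) * ‖a M‖ := by
        calc ‖a M‖ = ‖(E t M)⁻¹‖ * ‖∑ k, B M k * a k‖ := by rw [← norm_mul, ← h3]
          _ ≤ ‖(E t M)⁻¹‖ * ((∑ k, ‖B M k‖) * ‖a M‖) := by gcongr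
          _ = _ := by ring
      nlinarith
    subst hMo
    have hne : a M ≠ 0 := norm_pos_iff.mp hMpos
    refine ⟨fun m => a m / a M, div_self hne, fun m => ?_, fun m => ?_⟩
    · rw [norm_div]
      exact (div_le_one hMpos).mpr (hM m (Finset.mem_univ m))
    · rw [← mul_div_assoc, ha m, Finset.sum_div]
      simp only [mul_div_assoc]
  obtain ⟨a, ha⟩ := hnormal.choice
  have hlim : ∀ m, m ≠ o → Tendsto (fun t => a t m) l (𝓝 0) := by
    intro m hm
    have h := (hinv m hm).norm.mul_const (∑ k, ‖B m k‖)
    rw [norm_zero, zero_mul] at h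
    refine squeeze_zero_norm' ?_ h
    filter_upwards [ha, hE m hm] with t ⟨_, h1, h2⟩ h3
    have h4 : a t m = (E t m)⁻¹ * ∑ k, B m k * a t k := by
      rw [← h2 m, inv_mul_cancel_left₀ h3]
    rw [h4, norm_mul]
    refine mul_le_mul_of_nonneg_left (norm_sum_le_of_le _ fun k _ => ?_) (norm_nonneg _)
    rw [norm_mul]
    exact mul_le_of_le_one_right (norm_nonneg _) (h1 k)
  have hrow : ∀ᶠ t in l, B o o + ∑ m ∈ Finset.univ.erase o, B o m * a t m = 0 := by
    filter_upwards [ha] with t ⟨h1, _, h2⟩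
    have h3 := h2 o
    rw [hEo, zero_mul, ← Finset.add_sum_erase _ _ (Finset.mem_univ o), h1, mul_one] at h3
    exact h3.symm
  have hBoo : B o o = 0 := by
    have h : Tendsto (fun t => B o o + ∑ m ∈ Finset.univ.erase o, B o m * a t m) l
        (𝓝 (B o o + ∑ m ∈ Finset.univ.erase o, B o m * 0)) :=
      tendsto_const_nhds.add (tendsto_finsetSum _ fun m hm =>
        (hlim m (Finset.ne_of_mem_erase hm)).const_mul _)
    have h' := tendsto_nhds_unique (h.congr' hrow) tendsto_const_nhds
    simpa using h'
  refine ⟨hBoo, ?_⟩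
  have hsum : ∀ m, Tendsto (fun t => ∑ k, B m k * a t k) l (𝓝 (B m o)) := by
    intro m
    have h : Tendsto (fun t => ∑ k, B m k * a t k) l
        (𝓝 (∑ k, B m k * (if k = o then 1 else 0))) := by
      refine tendsto_finsetSum _ fun k _ => Tendsto.const_mul _ ?_
      split_ifs with hk
      · subst hk
        refine tendsto_const_nhds.congr' ?_
        filter_upwards [ha] with t ht using ht.1.symm
      · exact hlim k hk
    simpa using h
  have hscaled : ∀ m, m ≠ o → Tendsto (fun t => s t * a t m) l (𝓝 (β m * B m o)) := by
    intro m hm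
    refine ((hβ m hm).mul (hsum m)).congr' ?_
    filter_upwards [ha, hE m hm] with t ⟨_, _, h2⟩ h3
    rw [← h2 m]
    field_simp
  have h : Tendsto (fun t => ∑ m ∈ Finset.univ.erase o, B o m * (s t * a t m)) l
      (𝓝 (∑ m ∈ Finset.univ.erase o, B o m * (β m * B m o))) :=
    tendsto_finsetSum _ fun m hm => (hscaled m (Finset.ne_of_mem_erase hm)).const_mul _
  have h0 : Tendsto (fun t => ∑ m ∈ Finset.univ.erase o, B o m * (s t * a t m)) l (𝓝 0) := by
    refine tendsto_const_nhds.congr' ?_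
    filter_upwards [hrow] with t ht
    rw [hBoo, zero_add] at ht
    rw [← mul_zero (s t), ← ht, Finset.mul_sum]
    exact Finset.sum_congr rfl fun m _ => by ring
  rw [← tendsto_nhds_unique h h0]
  exact Finset.sum_congr rfl fun m _ => by ring

end Perturbation

theorem exists_add_inv_eq (y : ℂ) : ∃ z : ℂ, 1 ≤ ‖z‖ ∧ z + z⁻¹ = y := by
  obtain ⟨w, hw⟩ := IsAlgClosed.exists_pow_nat_eq (y ^ 2 - 4) two_pos
  have hprod : ((y + w) / 2) * ((y - w) / 2) = 1 := by linear_combination (-1 / 4) * hw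
  have hinv : ((y + w) / 2)⁻¹ = (y - w) / 2 := inv_eq_of_mul_eq_one_right hprod
  by_cases h : 1 ≤ ‖(y + w) / 2‖
  · exact ⟨_, h, by rw [hinv]; ring⟩
  · refine ⟨(y - w) / 2, ?_, ?_⟩
    · rw [← hinv, norm_inv]
      have h0 : 0 < ‖(y + w) / 2‖ := norm_pos_iff.mpr (left_ne_zero_of_mul_eq_one hprod)
      exact (one_le_inv₀ h0).mpr (not_le.mp h).le
    · rw [← hinv, inv_inv, hinv]; ring

section Torus

variable {J : Type*} [Fintype J] (q : J → ℕ) [∀ j, NeZero (q j)]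

/-- The standard primitive character `x ↦ ∏ⱼ exp(2πi xⱼ/qⱼ)` of `∏ⱼ ℤ/qⱼℤ`. -/
def torusChar : AddChar (∀ j, ZMod (q j)) ℂ where
  toFun x := ∏ j, ZMod.stdAddChar (x j)
  map_zero_eq_one' := by simp
  map_add_eq_mul' x y := by simp [AddChar.map_add_eq_mul, Finset.prod_mul_distrib]

theorem torusChar_mul_single [DecidableEq J] (m : ∀ j, ZMod (q j)) (j : J) :
    torusChar q (m * Pi.single j 1) = ZMod.stdAddChar (m j) := by
  change ∏ i, ZMod.stdAddChar ((m * Pi.single j 1 : ∀ j, ZMod (q j)) i) = _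
  rw [Finset.prod_eq_single j]
  · simp
  · intro i _ hi
    simp [Pi.single_eq_of_ne hi]
  · simp

theorem torusChar_isPrimitive [DecidableEq J] : (torusChar q).IsPrimitive := by
  intro m hm h
  apply hm
  ext j
  have h1 := DFunLike.congr_fun h (Pi.single j 1)
  rw [AddChar.mulShift_apply, torusChar_mul_single, AddChar.one_apply,
    ← AddChar.map_zero_eq_one (ZMod.stdAddChar (N := q j))] at h1
  exact ZMod.injective_stdAddChar h1

theorem norm_stdAddChar {N : ℕ} [NeZero N] (x : ZMod N) : ‖ZMod.stdAddChar x‖ = 1 := by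
  rw [ZMod.stdAddChar_apply, Circle.norm_coe]

theorem conj_torusChar (x : ∀ j, ZMod (q j)) :
    starRingEnd ℂ (torusChar q x) = torusChar q (-x) := by
  rw [AddChar.map_neg_eq_inv]
  refine (Complex.inv_eq_conj ?_).symm
  change ‖∏ i, ZMod.stdAddChar (x i)‖ = 1
  rw [norm_prod]
  exact Finset.prod_eq_one fun i _ => norm_stdAddChar _

/-- The matrix of multiplication by `V` in the basis of characters. -/
def fourierMatrix [DecidableEq J] (V : (∀ j, ZMod (q j)) → ℂ) (m k : ∀ j, ZMod (q j)) : ℂ :=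
  (Fintype.card (∀ j, ZMod (q j)) : ℂ)⁻¹ * ∑ g, V g * torusChar q ((k - m) * g)

theorem fourier_inversion [DecidableEq J] (v : (∀ j, ZMod (q j)) → ℂ) (h : ∀ j, ZMod (q j)) :
    ∑ k, (∑ g, v g * torusChar q (-(k * g))) * torusChar q (k * h)
      = Fintype.card (∀ j, ZMod (q j)) * v h := by
  simp only [Finset.sum_mul]
  rw [Finset.sum_comm]
  have h1 : ∀ g, ∑ k, v g * torusChar q (-(k * g)) * torusChar q (k * h)
      = v g * if h - g = 0 then (Fintype.card (∀ j, ZMod (q j)) : ℂ) else 0 := by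
    intro g
    have h2 := AddChar.sum_mulShift (h - g) (torusChar_isPrimitive q)
    push_cast at h2
    rw [← h2, Finset.mul_sum]
    refine Finset.sum_congr rfl fun k _ => ?_
    rw [mul_assoc, ← AddChar.map_add_eq_mul]
    congr 2
    ring
  simp only [h1, sub_eq_zero, mul_ite, mul_zero]
  rw [Finset.sum_ite_eq]
  simp [mul_comm]

theorem fourierMatrix_conj [DecidableEq J] (V : (∀ j, ZMod (q j)) → ℝ) (m k : ∀ j, ZMod (q j)) :
    fourierMatrix q (fun g => V g) k m
      = starRingEnd ℂ (fourierMatrix q (fun g => V g) m k) := by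
  simp only [fourierMatrix, map_mul, map_inv₀, map_natCast, map_sum, Complex.conj_ofReal,
    conj_torusChar]
  congr 1
  refine Finset.sum_congr rfl fun g _ => ?_
  congr 2
  ring

theorem eq_zero_of_fourierMatrix_zero [DecidableEq J] (V : (∀ j, ZMod (q j)) → ℂ)
    (h : ∀ k, fourierMatrix q V 0 k = 0) : V = 0 := by
  have hcard : (Fintype.card (∀ j, ZMod (q j)) : ℂ) ≠ 0 :=
    Nat.cast_ne_zero.mpr Fintype.card_ne_zero
  ext g
  have h1 := fourier_inversion q V g
  rw [Finset.sum_eq_zero] at h1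
  · exact (mul_eq_zero.mp h1.symm).resolve_left hcard
  · intro k _
    have h2 := h (-k)
    rw [fourierMatrix, mul_eq_zero, inv_eq_zero, or_iff_right hcard] at h2
    simp only [sub_zero, neg_mul] at h2
    rw [h2, zero_mul]

theorem exists_fourier_kernel [DecidableEq J] (V v : (∀ j, ZMod (q j)) → ℂ) (hv : v ≠ 0) (z : J → ℂ) (lam : ℂ)
    (h : ∀ g, ∑ j, (z j * v (g + Pi.single j 1) + (z j)⁻¹ * v (g - Pi.single j 1)) + lam * v g
      = V g * v g) :
    ∃ a : (∀ j, ZMod (q j)) → ℂ, a ≠ 0 ∧ ∀ m,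
      (∑ j, (z j * ZMod.stdAddChar (m j) + (z j * ZMod.stdAddChar (m j))⁻¹) + lam) * a m
        = ∑ k, fourierMatrix q V m k * a k := by
  have hcard : (Fintype.card (∀ j, ZMod (q j)) : ℂ) ≠ 0 :=
    Nat.cast_ne_zero.mpr Fintype.card_ne_zero
  refine ⟨fun m => ∑ g, v g * torusChar q (-(m * g)), fun ha => hv ?_, fun m => ?_⟩
  · ext x
    have h1 := fourier_inversion q v x
    have h2 : ∀ k, ∑ g, v g * torusChar q (-(k * g)) = 0 := fun k => congr_fun ha k
    simp only [h2, zero_mul, Finset.sum_const_zero] at h1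
    exact (mul_eq_zero.mp h1.symm).resolve_left hcard
  have hshift : ∀ c : ∀ j, ZMod (q j), ∑ g, v (g + c) * torusChar q (-(m * g))
      = torusChar q (m * c) * ∑ g, v g * torusChar q (-(m * g)) := by
    intro c
    rw [← Equiv.sum_comp (Equiv.addRight c) (fun g => v g * torusChar q (-(m * g))),
      Finset.mul_sum]
    refine Finset.sum_congr rfl fun g _ => ?_
    rw [mul_left_comm, ← AddChar.map_add_eq_mul, Equiv.coe_addRight]
    congr 2
    ring
  have hR : ∑ k, fourierMatrix q V m k * ∑ g, v g * torusChar q (-(k * g))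
      = ∑ g, V g * v g * torusChar q (-(m * g)) := by
    simp only [fourierMatrix, mul_assoc, ← Finset.mul_sum]
    rw [inv_mul_eq_iff_eq_mul₀ hcard, Finset.mul_sum]
    simp only [Finset.sum_mul]
    rw [Finset.sum_comm]
    refine Finset.sum_congr rfl fun g _ => ?_
    have h1 := fourier_inversion q v g
    calc _ = V g * torusChar q (-(m * g)) *
          ∑ k, (∑ g, v g * torusChar q (-(k * g))) * torusChar q (k * g) := by
          rw [Finset.mul_sum]
          refine Finset.sum_congr rfl fun k _ => ?_
          have h2 : (k - m) * g = -(m * g) + k * g := by ring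
          rw [h2, AddChar.map_add_eq_mul]
          ring
      _ = _ := by rw [h1]; ring
  rw [hR]
  simp only [← h, add_mul, Finset.sum_mul, Finset.sum_add_distrib]
  rw [Finset.sum_comm (s := Finset.univ (α := ∀ j, ZMod (q j))),
    Finset.sum_comm (s := Finset.univ (α := ∀ j, ZMod (q j)))]
  simp only [mul_assoc, ← Finset.mul_sum, sub_eq_add_neg, hshift, mul_neg, torusChar_mul_single,
    AddChar.map_neg_eq_inv (torusChar q) (m * Pi.single _ 1), mul_inv]

/-- The leading symbol `x ↦ ∑ⱼ exp(2πi mⱼ/qⱼ) xⱼ` of the free operator at the frequency `m`. -/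
def symbolForm (m : ∀ j, ZMod (q j)) : Module.Dual ℂ (J → ℂ) :=
  ∑ j, (ZMod.stdAddChar (m j) : ℂ) • LinearMap.proj j

theorem symbolForm_apply (m : ∀ j, ZMod (q j)) (x : J → ℂ) :
    symbolForm q m x = ∑ j, ZMod.stdAddChar (m j) * x j := by
  simp [symbolForm]

theorem symbolForm_single [DecidableEq J] (m : ∀ j, ZMod (q j)) (j : J) (c : ℂ) :
    symbolForm q m (Pi.single j c) = ZMod.stdAddChar (m j) * c := by
  rw [symbolForm_apply, Finset.sum_eq_single j]
  · simp
  · intro i _ hi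
    simp [Pi.single_eq_of_ne hi]
  · simp

section Asymptotics

open Filter Topology

theorem schur_condition [DecidableEq J] [Nonempty J] (B : (∀ j, ZMod (q j)) → (∀ j, ZMod (q j)) → ℂ) (lam : ℂ)
    (hker : ∀ z : J → ℂ, (∀ j, z j ≠ 0) → ∑ j, (z j + (z j)⁻¹) = -lam →
      ∃ a : (∀ j, ZMod (q j)) → ℂ, a ≠ 0 ∧ ∀ m,
        (∑ j, (z j * ZMod.stdAddChar (m j) + (z j * ZMod.stdAddChar (m j))⁻¹) + lam) * a m
          = ∑ k, B m k * a k)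
    (x w : J → ℂ) (hx : symbolForm q 0 x = 0) (hw : symbolForm q 0 w = 0)
    (hxw : ∀ m, m ≠ 0 → symbolForm q m x = 0 → symbolForm q m w ≠ 0) :
    B 0 0 = 0 ∧ ∑ m ∈ Finset.univ.erase 0, B 0 m * B m 0 *
      (if symbolForm q m x = 0 then (symbolForm q m w)⁻¹ else 0) = 0 := by
  obtain ⟨j₀⟩ := ‹Nonempty J›
  set p : J → ℂ := Pi.single j₀ (-lam) with hp
  choose joukowski hnorm hjouk using exists_add_inv_eq
  let y : ℝ → J → ℂ := fun t => (t : ℂ) ^ 2 • x + (t : ℂ) • w + p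
  let z : ℝ → J → ℂ := fun t j => joukowski (y t j)
  have hz1 : ∀ t j, 1 ≤ ‖z t j‖ := fun t j => hnorm _
  have hz0 : ∀ t j, z t j ≠ 0 := fun t j => norm_pos_iff.mp (one_pos.trans_le (hz1 t j))
  have hzy : ∀ t j, z t j + (z t j)⁻¹ = y t j := fun t j => hjouk _
  have hsumy : ∀ t, ∑ j, y t j = -lam := by
    intro t
    have h : symbolForm q 0 (y t) = -lam := by
      simp only [y, map_add, map_smul, hx, hw, smul_zero, zero_add, hp, symbolForm_single]
      simp
    simpa [symbolForm_apply] using h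
  let E : ℝ → (∀ j, ZMod (q j)) → ℂ := fun t m =>
    ∑ j, (z t j * ZMod.stdAddChar (m j) + (z t j * ZMod.stdAddChar (m j))⁻¹) + lam
  let R : ℝ → (∀ j, ZMod (q j)) → ℂ := fun t m => symbolForm q m p
    + ∑ j, ((ZMod.stdAddChar (m j))⁻¹ - ZMod.stdAddChar (m j)) * (z t j)⁻¹ + lam
  have hE : ∀ t m, E t m = (t : ℂ) ^ 2 * symbolForm q m x + t * symbolForm q m w + R t m := by
    intro t m
    have h : symbolForm q m (y t)
        = (t : ℂ) ^ 2 * symbolForm q m x + t * symbolForm q m w + symbolForm q m p := by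
      simp only [y, map_add, map_smul, smul_eq_mul]
    simp only [E, R]
    rw [← add_assoc, ← add_assoc, ← h, symbolForm_apply, ← Finset.sum_add_distrib]
    congr 1
    refine Finset.sum_congr rfl fun j _ => ?_
    rw [← hzy, mul_inv]
    ring
  have hR : ∀ m, ∃ C, ∀ t, ‖R t m‖ ≤ C := by
    intro m
    refine ⟨‖symbolForm q m p‖ + ∑ _j : J, 2 + ‖lam‖, fun t => ?_⟩
    refine (norm_add₃_le).trans ?_
    gcongr
    refine norm_sum_le_of_le _ fun j _ => ?_
    rw [norm_mul, norm_inv]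
    have h1 : ‖(ZMod.stdAddChar (m j) : ℂ)⁻¹ - ZMod.stdAddChar (m j)‖ ≤ 2 := by
      refine (norm_sub_le _ _).trans ?_
      rw [norm_inv, norm_stdAddChar]
      norm_num
    have h2 : ‖z t j‖⁻¹ ≤ 1 := inv_le_one_of_one_le₀ (hz1 t j)
    calc _ ≤ (2 : ℝ) * 1 := by gcongr
      _ = 2 := by norm_num
  have hs : Tendsto (fun t : ℝ => ((t : ℂ))⁻¹) atTop (𝓝 0) := by
    rw [tendsto_zero_iff_norm_tendsto_zero]
    simp only [norm_inv, Complex.norm_real]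
    exact tendsto_inv_atTop_zero.comp tendsto_norm_atTop_atTop
  have hs0 : ∀ᶠ t : ℝ in atTop, (t : ℂ) ≠ 0 := by
    filter_upwards [eventually_gt_atTop 0] with t ht
    exact Complex.ofReal_ne_zero.mpr ht.ne'
  have hRs : ∀ m, Tendsto (fun t : ℝ => (t : ℂ)⁻¹ * R t m) atTop (𝓝 0) := by
    intro m
    obtain ⟨C, hC⟩ := hR m
    have h := hs.norm.mul_const C
    rw [norm_zero, zero_mul] at h
    refine squeeze_zero_norm (fun t => ?_) h
    rw [norm_mul]
    exact mul_le_mul_of_nonneg_left (hC t) (norm_nonneg _)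
  have hlim₁ : ∀ m, symbolForm q m x = 0 →
      Tendsto (fun t : ℝ => (t : ℂ)⁻¹ * E t m) atTop (𝓝 (symbolForm q m w)) := by
    intro m hm
    have h := (hRs m).const_add (symbolForm q m w)
    rw [add_zero] at h
    refine h.congr' ?_
    filter_upwards [hs0] with t ht
    rw [hE, hm]
    field_simp
    ring
  have hlim₂ : ∀ m,
      Tendsto (fun t : ℝ => (t : ℂ)⁻¹ * ((t : ℂ)⁻¹ * E t m)) atTop (𝓝 (symbolForm q m x)) := by
    intro m
    have h := (((hs.mul (hRs m)).const_add (symbolForm q m x)).add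
      (hs.mul_const (symbolForm q m w)))
    rw [mul_zero, zero_mul, add_zero, add_zero] at h
    refine h.congr' ?_
    filter_upwards [hs0] with t ht
    rw [hE]
    field_simp
    ring
  refine schur_expansion_eq_zero (l := atTop) B 0 E (fun t : ℝ => (t : ℂ)) _ hs hs0 ?_ ?_ ?_ ?_
  · intro t
    have h : ∑ j, (z t j + (z t j)⁻¹) = -lam := by simp only [hzy, hsumy]
    simp [E, h]
  · intro m hm
    by_cases hmx : symbolForm q m x = 0
    · filter_upwards [(hlim₁ m hmx).eventually_ne (hxw m hm hmx)] with t ht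
      exact right_ne_zero_of_mul ht
    · filter_upwards [(hlim₂ m).eventually_ne hmx] with t ht
      exact right_ne_zero_of_mul (right_ne_zero_of_mul ht)
  · intro m hm
    split_ifs with hmx
    · refine ((hlim₁ m hmx).inv₀ (hxw m hm hmx)).congr fun t => ?_
      rw [mul_inv, inv_inv, div_eq_mul_inv]
    · have h := hs.mul ((hlim₂ m).inv₀ hmx)
      rw [zero_mul] at h
      refine h.congr' ?_
      filter_upwards [hs0] with t ht
      field_simp
  · intro t
    exact hker (z t) (hz0 t) (by simp only [hzy, hsumy])

end Asymptotics

theorem stdAddChar_eq_one_iff {N : ℕ} [NeZero N] {x : ZMod N} :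
    ZMod.stdAddChar x = 1 ↔ x = 0 := by
  rw [← AddChar.map_zero_eq_one (ZMod.stdAddChar (N := N)), ZMod.injective_stdAddChar.eq_iff]

theorem stdAddChar_pow_self {N : ℕ} [NeZero N] (x : ZMod N) : ZMod.stdAddChar x ^ N = 1 := by
  rw [← AddChar.map_nsmul_eq_pow]
  simp

theorem eq_zero_of_stdAddChar_eq {M N : ℕ} [NeZero M] [NeZero N] (h : M.Coprime N) {x : ZMod M}
    {y : ZMod N} (hxy : ZMod.stdAddChar x = ZMod.stdAddChar y) : x = 0 ∧ y = 0 := by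
  have h1 : ZMod.stdAddChar x ^ M.gcd N = 1 :=
    pow_gcd_eq_one.mpr ⟨stdAddChar_pow_self x, hxy ▸ stdAddChar_pow_self y⟩
  rw [h.gcd_eq_one, pow_one] at h1
  exact ⟨stdAddChar_eq_one_iff.mp h1, stdAddChar_eq_one_iff.mp (hxy ▸ h1)⟩

/-- Similar triangles inscribed in the unit circle with the same orientation are either degenerate
or rotations of each other. -/
theorem rotation_of_similar {A B C α β γ : ℂ} (hA : ‖A‖ = 1) (hB : ‖B‖ = 1) (hC : ‖C‖ = 1)
    (hα : ‖α‖ = 1) (hβ : ‖β‖ = 1) (hγ : ‖γ‖ = 1) (hBC : B ≠ C) (hCA : C ≠ A)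
    (h : α * (B - C) + β * (C - A) + γ * (A - B) = 0) : α = β ∨ B * α = A * β := by
  have ne : ∀ {u : ℂ}, ‖u‖ = 1 → u ≠ 0 := fun hu => norm_ne_zero_iff.mp (hu ▸ one_ne_zero)
  have hc := congr_arg (starRingEnd ℂ) h
  simp only [map_add, map_mul, map_sub, map_zero, ← Complex.inv_eq_conj hA,
    ← Complex.inv_eq_conj hB, ← Complex.inv_eq_conj hC, ← Complex.inv_eq_conj hα,
    ← Complex.inv_eq_conj hβ, ← Complex.inv_eq_conj hγ] at hc
  have hA0 := ne hA
  have hB0 := ne hB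
  have hC0 := ne hC
  have hα0 := ne hα
  have hβ0 := ne hβ
  have hγ0 := ne hγ
  have h2 : A * β * γ * (B - C) + B * α * γ * (C - A) + C * α * β * (A - B) = 0 := by
    have : A * β * γ * (B - C) + B * α * γ * (C - A) + C * α * β * (A - B)
      = -(A * B * C * α * β * γ) * (α⁻¹ * (B⁻¹ - C⁻¹) + β⁻¹ * (C⁻¹ - A⁻¹) + γ⁻¹ * (A⁻¹ - B⁻¹)) := by
      field_simp
      ring
    rw [this, hc, mul_zero]
  have h3 : (B - C) * (C - A) * ((α - β) * (B * α - A * β)) = 0 := by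
    linear_combination (A * β * (B - C) + B * α * (C - A)) * h - (A - B) * h2
  simpa [sub_eq_zero, hBC, hCA] using h3

theorem exists_generic_mem (p : Submodule ℂ (J → ℂ)) :
    ∃ x ∈ p, ∀ m, symbolForm q m x = 0 → ∀ y ∈ p, symbolForm q m y = 0 := by
  let T := {m : ∀ j, ZMod (q j) // ∃ y ∈ p, symbolForm q m y ≠ 0}
  obtain ⟨x, hxp, hx⟩ := Module.Dual.exists_forall_mem_ne_zero_of_forall_exists p
    (fun m : T => symbolForm q m.1) (fun m => m.2)
  refine ⟨x, hxp, fun m hm => ?_⟩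
  by_contra! h
  exact hx ⟨m, h⟩ hm


theorem stdAddChar_ne_of_ne_zero {ι : Type*} {q : ι → ℕ} [∀ j, NeZero (q j)]
    (hq : ∀ i j, i ≠ j → (q i).Coprime (q j)) (l : ∀ j, ZMod (q j)) {i k : ι} (hik : i ≠ k)
    (hi : l i ≠ 0) : (ZMod.stdAddChar (l i) : ℂ) ≠ ZMod.stdAddChar (l k) :=
  fun h => hi (eq_zero_of_stdAddChar_eq (hq i k hik) h).1

/-- If the symbol at `m` vanishes wherever those at `0` and `l` do, and `l` has two nonzero
components, then `m = 0` or `m = l`. -/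
theorem eq_zero_or_eq_of_symbolForm (hq : ∀ i j, i ≠ j → (q i).Coprime (q j))
    (hJ : ∀ i j : J, ∃ k, k ≠ i ∧ k ≠ j) {l m : ∀ j, ZMod (q j)} {i j : J} (hij : i ≠ j)
    (hi : l i ≠ 0) (hj : l j ≠ 0)
    (h : ∀ y, symbolForm q 0 y = 0 → symbolForm q l y = 0 → symbolForm q m y = 0) :
    m = 0 ∨ m = l := by
  classical
  have hrel : ∀ k, k ≠ i → k ≠ j →
      ZMod.stdAddChar (m i) * (ZMod.stdAddChar (l j) - ZMod.stdAddChar (l k))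
      + ZMod.stdAddChar (m j) * (ZMod.stdAddChar (l k) - ZMod.stdAddChar (l i))
      + ZMod.stdAddChar (m k) * (ZMod.stdAddChar (l i) - ZMod.stdAddChar (l j)) = (0 : ℂ) := by
    intro k _ _
    have h1 := h (Pi.single i (ZMod.stdAddChar (l j) - ZMod.stdAddChar (l k))
      + Pi.single j (ZMod.stdAddChar (l k) - ZMod.stdAddChar (l i))
      + Pi.single k (ZMod.stdAddChar (l i) - ZMod.stdAddChar (l j)))
    simp only [map_add, symbolForm_single] at h1
    refine h1 ?_ ?_
    · simp
    · ring
  have hlij : (ZMod.stdAddChar (l i) : ℂ) - ZMod.stdAddChar (l j) ≠ 0 :=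
    sub_ne_zero.mpr (stdAddChar_ne_of_ne_zero hq l hij hi)
  obtain ⟨k₀, hki, hkj⟩ := hJ i j
  rcases rotation_of_similar (norm_stdAddChar (l i)) (norm_stdAddChar (l j))
    (norm_stdAddChar (l k₀)) (norm_stdAddChar (m i)) (norm_stdAddChar (m j))
    (norm_stdAddChar (m k₀)) (stdAddChar_ne_of_ne_zero hq l hkj.symm hj)
    (stdAddChar_ne_of_ne_zero hq l hki.symm hi).symm (hrel k₀ hki hkj) with h1 | h1
  · left
    obtain ⟨hmi, hmj⟩ := eq_zero_of_stdAddChar_eq (hq i j hij) h1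
    ext k
    by_cases hk : k = i
    · rw [hk, hmi, Pi.zero_apply]
    by_cases hk' : k = j
    · rw [hk', hmj, Pi.zero_apply]
    have h2 := hrel k hk hk'
    rw [hmi, hmj, AddChar.map_zero_eq_one, AddChar.map_zero_eq_one] at h2
    refine stdAddChar_eq_one_iff.mp (mul_right_cancel₀ hlij ?_)
    linear_combination h2
  · right
    have hne : ∀ k, (ZMod.stdAddChar (l k) : ℂ) ≠ 0 := fun k =>
      norm_ne_zero_iff.mp ((norm_stdAddChar (l k)).symm ▸ one_ne_zero)
    have h2 : (ZMod.stdAddChar (m i - l i) : ℂ) = ZMod.stdAddChar (m j - l j) := by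
      rw [AddChar.map_sub_eq_div, AddChar.map_sub_eq_div, div_eq_div_iff (hne i) (hne j)]
      linear_combination h1
    obtain ⟨hmi, hmj⟩ := eq_zero_of_stdAddChar_eq (hq i j hij) h2
    rw [sub_eq_zero] at hmi hmj
    ext k
    by_cases hk : k = i
    · rw [hk, hmi]
    by_cases hk' : k = j
    · rw [hk', hmj]
    have h3 := hrel k hk hk'
    rw [hmi, hmj] at h3
    refine ZMod.injective_stdAddChar (mul_right_cancel₀ hlij ?_)
    linear_combination h3

theorem re_inv_sub_one {u : ℂ} (hu : ‖u‖ = 1) (h1 : u ≠ 1) : ((u - 1)⁻¹).re = -1 / 2 := by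
  have h2 : u.re * u.re + u.im * u.im = 1 := by
    rw [← Complex.normSq_apply, Complex.normSq_eq_norm_sq, hu, one_pow]
  have h3 : Complex.normSq (u - 1) ≠ 0 := by simpa [sub_eq_zero] using h1
  rw [Complex.inv_re, div_eq_iff h3, Complex.normSq_apply]
  simp only [Complex.sub_re, Complex.sub_im, Complex.one_re, Complex.one_im]
  linear_combination (1 / 2) * h2

/-- A potential whose Fourier matrix has a kernel vector over every point of the Fermi variety of
the zero potential vanishes. -/
theorem eq_zero_of_fourier_kernel [DecidableEq J] (hq : ∀ i j, i ≠ j → (q i).Coprime (q j)) [Nonempty J]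
    (hJ : ∀ i j : J, ∃ k, k ≠ i ∧ k ≠ j) (V : (∀ j, ZMod (q j)) → ℝ) (lam : ℂ)
    (hker : ∀ z : J → ℂ, (∀ j, z j ≠ 0) → ∑ j, (z j + (z j)⁻¹) = -lam →
      ∃ a : (∀ j, ZMod (q j)) → ℂ, a ≠ 0 ∧ ∀ m,
        (∑ j, (z j * ZMod.stdAddChar (m j) + (z j * ZMod.stdAddChar (m j))⁻¹) + lam) * a m
          = ∑ k, fourierMatrix q (fun g => V g) m k * a k) :
    V = 0 := by
  set B := fourierMatrix q (fun g => (V g : ℂ)) with hB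
  have hBB : ∀ m, B 0 m * B m 0 = (Complex.normSq (B 0 m) : ℂ) := by
    intro m
    rw [hB, fourierMatrix_conj q V 0 m, Complex.mul_conj]
  obtain ⟨w, hw0, hw⟩ := exists_generic_mem q (LinearMap.ker (symbolForm q 0))
  have hwm : ∀ m, m ≠ 0 → symbolForm q m w ≠ 0 := by
    intro m hm hmw
    apply hm
    ext i
    obtain ⟨k, hki, -⟩ := hJ i i
    have h1 := hw m hmw (Pi.single i 1 - Pi.single k 1) (by
      rw [LinearMap.mem_ker, map_sub, symbolForm_single, symbolForm_single]
      simp)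
    rw [map_sub, symbolForm_single, symbolForm_single, mul_one, mul_one, sub_eq_zero] at h1
    exact (eq_zero_of_stdAddChar_eq (hq i k hki.symm) h1).1
  have key := fun x hx => schur_condition q B lam hker x w hx hw0 fun m hm _ => hwm m hm
  simp only [hBB] at key
  suffices h : ∀ l, B 0 l = 0 by
    have h1 := eq_zero_of_fourierMatrix_zero q _ h
    ext g
    exact Complex.ofReal_eq_zero.mp (congr_fun h1 g)
  intro l
  by_cases hl : l = 0
  · rw [hl]
    exact (key 0 (map_zero _)).1
  obtain ⟨i, hi⟩ := Function.ne_iff.mp hl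
  rw [Pi.zero_apply] at hi
  by_cases hl' : ∃ j, i ≠ j ∧ l j ≠ 0
  · obtain ⟨j, hij, hj⟩ := hl'
    obtain ⟨x, hx, hgen⟩ :=
      exists_generic_mem q (LinearMap.ker (symbolForm q 0) ⊓ LinearMap.ker (symbolForm q l))
    have h1 := (key x hx.1).2
    rw [Finset.sum_eq_single l] at h1
    · have hlx : symbolForm q l x = 0 := hx.2
      rw [if_pos hlx] at h1
      simpa [hwm l hl] using h1
    · intro m hm hml
      rw [if_neg, mul_zero]
      intro hmx
      rcases eq_zero_or_eq_of_symbolForm q hq hJ hij hi hj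
        (fun y h0 h1 => hgen m hmx y ⟨h0, h1⟩) with h | h
      · exact Finset.ne_of_mem_erase hm h
      · exact hml h
    · intro h
      exact absurd (Finset.mem_erase.mpr ⟨hl, Finset.mem_univ l⟩) h
  · push Not at hl'
    obtain ⟨x, hx, hgen⟩ := exists_generic_mem q
      (LinearMap.ker (symbolForm q 0) ⊓ LinearMap.ker (LinearMap.proj i))
    have hx0 : symbolForm q 0 x = 0 := hx.1
    have hxi : x i = 0 := hx.2
    have haxis : ∀ m, symbolForm q m x = 0 → ∀ j, i ≠ j → m j = 0 := by
      intro m hmx j hij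
      obtain ⟨k, hki, hkj⟩ := hJ i j
      have h1 := hgen m hmx (Pi.single j 1 - Pi.single k 1) ⟨by
        rw [SetLike.mem_coe, LinearMap.mem_ker, map_sub, symbolForm_single, symbolForm_single]
        simp, by simp [hij, hki.symm]⟩
      rw [map_sub, symbolForm_single, symbolForm_single, mul_one, mul_one, sub_eq_zero] at h1
      exact (eq_zero_of_stdAddChar_eq (hq j k hkj.symm) h1).1
    have haxis_form : ∀ (m : ∀ j, ZMod (q j)) (y : J → ℂ), (∀ j, i ≠ j → m j = 0) →
        symbolForm q 0 y = 0 → symbolForm q m y = (ZMod.stdAddChar (m i) - 1) * y i := by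
      intro m y hm hy
      rw [← sub_zero (symbolForm q m y), ← hy, symbolForm_apply, symbolForm_apply,
        ← Finset.sum_sub_distrib, Finset.sum_eq_single i]
      · simp [sub_mul]
      · intro j _ hj
        simp [hm j hj.symm]
      · simp
    have hlx : symbolForm q l x = 0 := by rw [haxis_form l x hl' hx0, hxi, mul_zero]
    have hwi : w i ≠ 0 := by
      have h := hwm l hl
      rw [haxis_form l w hl' hw0] at h
      exact right_ne_zero_of_mul h
    have hre : ∀ m ∈ Finset.univ.erase (0 : ∀ j, ZMod (q j)),
        (((Complex.normSq (B 0 m) : ℂ) *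
          if symbolForm q m x = 0 then (symbolForm q m w)⁻¹ else 0) * w i).re
        = -(if symbolForm q m x = 0 then Complex.normSq (B 0 m) / 2 else 0) := by
      intro m hm
      split_ifs with hmx
      · have hmi : m i ≠ 0 := by
          intro h
          apply Finset.ne_of_mem_erase hm
          ext j
          by_cases hj : i = j
          · rw [← hj, h, Pi.zero_apply]
          · rw [haxis m hmx j hj, Pi.zero_apply]
        rw [haxis_form m w (haxis m hmx) hw0, mul_inv, mul_assoc, inv_mul_cancel_right₀ hwi,
          Complex.re_ofReal_mul, re_inv_sub_one (norm_stdAddChar _)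
            (fun h => hmi (stdAddChar_eq_one_iff.mp h))]
        ring
      · simp
    have h1 := congr_arg (fun c => (c * w i).re) (key x hx0).2
    simp only [Finset.sum_mul, Complex.re_sum, zero_mul, Complex.zero_re] at h1
    rw [Finset.sum_congr rfl hre, Finset.sum_neg_distrib, neg_eq_zero,
      Finset.sum_eq_zero_iff_of_nonneg] at h1
    · have h2 := h1 l (Finset.mem_erase.mpr ⟨hl, Finset.mem_univ l⟩)
      rw [if_pos hlx] at h2
      simpa using h2
    · intro m _
      split_ifs
      · exact div_nonneg (Complex.normSq_nonneg _) two_pos.le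
      · exact le_rfl

end Torus

theorem periodic_eq_of_cast_eq {d : ℕ} (q : Fin d → ℕ+) {R : Type*} {f : (Fin d → ℤ) → R}
    (hf : ∀ n j, f (Function.update n j (n j + ((q j : ℕ) : ℤ))) = f n) {n n' : Fin d → ℤ}
    (h : ∀ j, (n j : ZMod (q j : ℕ)) = n' j) : f n = f n' := by
  have hstep : ∀ n (j : Fin d), f (n + Pi.single j ((q j : ℕ) : ℤ)) = f n := by
    intro n j
    rw [← hf n j]
    congr 1
    ext i
    by_cases hi : i = j
    · subst hi; simp
    · simp [hi]
  let P : AddSubgroup (Fin d → ℤ) :=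
    { carrier := {p | ∀ n, f (n + p) = f n}
      zero_mem' := fun n => by rw [add_zero]
      add_mem' := fun {a b} ha hb n => by rw [← add_assoc, hb, ha]
      neg_mem' := fun {a} ha n => by rw [← ha (n + -a), neg_add_cancel_right] }
  choose c hc using fun j => (ZMod.intCast_eq_intCast_iff_dvd_sub _ _ _).mp (h j)
  have hmem : n' - n ∈ P := by
    have h1 : n' - n = ∑ j, c j • Pi.single j ((q j : ℕ) : ℤ) := by
      ext i
      rw [Finset.sum_apply, Finset.sum_eq_single i]
      · simp [hc i, mul_comm]
      · intro j _ hj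
        simp [hj.symm]
      · simp
    rw [h1]
    exact P.sum_mem fun j _ => P.zsmul_mem (fun n => hstep n j) _
  rw [← hmem n, add_sub_cancel]

theorem prod_zpow_update {d : ℕ} {z : Fin d → ℂ} (hz : ∀ j, z j ≠ 0) (n : Fin d → ℤ) (j : Fin d)
    (c : ℤ) : ∏ i, z i ^ Function.update n j (n j + c) i = (∏ i, z i ^ n i) * z j ^ c := by
  rw [← Finset.mul_prod_erase _ _ (Finset.mem_univ j),
    ← Finset.mul_prod_erase _ (fun i => z i ^ n i) (Finset.mem_univ j), Function.update_self,
    zpow_add₀ (hz j), Finset.prod_congr rfl fun i hi => by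
      rw [Function.update_of_ne (Finset.ne_of_mem_erase hi)]]
  ring

theorem exists_exp_eq_pow {c : ℂ} (hc : c ≠ 0) :
    ∃ k : ℂ, Complex.exp (2 * (Real.pi : ℂ) * Complex.I * k) = c :=
  ⟨Complex.log c / (2 * (Real.pi : ℂ) * Complex.I), by
    rw [mul_div_cancel₀ _ Complex.two_pi_I_ne_zero, Complex.exp_log hc]⟩

/-- Dividing a Floquet solution by the plane wave `∏ⱼ zⱼ ^ nⱼ` gives a function on the torus. -/
theorem exists_torus_solution {d : ℕ} (q : Fin d → ℕ+) (V : (Fin d → ℤ) → ℝ) (lam : ℂ)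
    (hiso : FermiVariety q (fun _ => (0 : ℂ)) lam
      ⊆ FermiVariety q (fun n => ((V n : ℝ) : ℂ)) lam)
    (z : Fin d → ℂ) (hz : ∀ j, z j ≠ 0) (hsum : ∑ j, (z j + (z j)⁻¹) = -lam) :
    ∃ v : (∀ j, ZMod (q j : ℕ)) → ℂ, v ≠ 0 ∧ ∀ g,
      ∑ j, (z j * v (g + Pi.single j 1) + (z j)⁻¹ * v (g - Pi.single j 1)) + lam * v g
        = (V fun j => ((g j).val : ℤ)) * v g := by
  have hP0 : ∀ n : Fin d → ℤ, ∏ i, z i ^ n i ≠ 0 := fun n =>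
    Finset.prod_ne_zero_iff.mpr fun i _ => zpow_ne_zero _ (hz i)
  choose k hk using fun j => exists_exp_eq_pow (zpow_ne_zero ((q j : ℕ) : ℤ) (hz j))
  have hmem : k ∈ FermiVariety q (fun _ => (0 : ℂ)) lam := by
    refine ⟨fun n => ∏ i, z i ^ n i, fun h => hP0 0 (congr_fun h 0), fun n => ?_, fun n j => ?_⟩
    · simp only [discLap, sub_eq_add_neg, prod_zpow_update hz, ← mul_add, ← Finset.mul_sum]
      simp only [zpow_one, zpow_neg_one, hsum]
      ring
    · simp only [prod_zpow_update hz, hk]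
      ring
  obtain ⟨u, hu0, hu, huq⟩ := hiso hmem
  let f : (Fin d → ℤ) → ℂ := fun n => (∏ i, z i ^ n i)⁻¹ * u n
  have hf : ∀ n j, f (Function.update n j (n j + ((q j : ℕ) : ℤ))) = f n := by
    intro n j
    simp only [f, prod_zpow_update hz, huq, hk]
    have := zpow_ne_zero ((q j : ℕ) : ℤ) (hz j)
    have := hP0 n
    field_simp
  have huf : ∀ n, u n = (∏ i, z i ^ n i) * f n := fun n => by
    simp only [f, mul_inv_cancel_left₀ (hP0 n)]
  refine ⟨fun g => f fun j => ((g j).val : ℤ), fun h => hu0 ?_, fun g => ?_⟩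
  · ext n
    have h1 : f n = 0 := by
      refine Eq.trans ?_ (congr_fun h fun j => (n j : ZMod (q j : ℕ)))
      exact periodic_eq_of_cast_eq q hf fun j => by simp
    rw [huf, h1, mul_zero, Pi.zero_apply]
  · set n : Fin d → ℤ := fun j => ((g j).val : ℤ) with hn
    have hplus : ∀ j, f (fun i => (((g + Pi.single j 1 : ∀ j, ZMod (q j : ℕ)) i).val : ℤ))
        = f (Function.update n j (n j + 1)) := by
      intro j
      refine periodic_eq_of_cast_eq q hf fun i => ?_
      by_cases hi : i = j
      · subst hi; simp [hn]
      · simp [hn, hi]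
    have hminus : ∀ j, f (fun i => (((g - Pi.single j 1 : ∀ j, ZMod (q j : ℕ)) i).val : ℤ))
        = f (Function.update n j (n j + -1)) := by
      intro j
      refine periodic_eq_of_cast_eq q hf fun i => ?_
      by_cases hi : i = j
      · subst hi; simp [hn, sub_eq_add_neg]
      · simp [hn, hi]
    have h1 := hu n
    simp only [discLap, sub_eq_add_neg, huf, prod_zpow_update hz, mul_assoc, ← mul_add,
      ← Finset.mul_sum, zpow_one, zpow_neg_one] at h1
    simp only [hplus, hminus]
    refine mul_left_cancel₀ (hP0 n) ?_
    linear_combination -h1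

/-- Let `d ≥ 3` and let `V` be a real `Γ`-periodic potential on
`ℤ^d`.  If `V` and the zero potential are Fermi isospectral, i.e.
`F_{λ₀}(V) = F_{λ₀}(0)` for some `λ₀ ∈ ℂ`, then `V ≡ 0`. -/
theorem statement16 (d : ℕ) (hd : 3 ≤ d) (q : Fin d → ℕ+)
    (hq : ∀ i j, i ≠ j → Nat.Coprime (q i) (q j))
    (V : (Fin d → ℤ) → ℝ) (hV : IsPeriodicR q V)
    (lam0 : ℂ)
    (hiso : FermiVariety q (fun n => ((V n : ℝ) : ℂ)) lam0
      = FermiVariety q (fun _ => (0 : ℂ)) lam0) :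
    ∀ n : Fin d → ℤ, V n = 0 := by
  have hJ : ∀ i j : Fin d, ∃ k, k ≠ i ∧ k ≠ j := by
    intro i j
    obtain ⟨k, hk⟩ := Finset.exists_mem_notMem_of_card_lt_card (s := {i, j}) (t := Finset.univ)
      (lt_of_le_of_lt Finset.card_le_two (by rw [Finset.card_univ, Fintype.card_fin]; omega))
    exact ⟨k, by simpa using hk⟩
  have : Nonempty (Fin d) := ⟨⟨0, by omega⟩⟩
  have h := eq_zero_of_fourier_kernel (fun j => (q j : ℕ)) hq hJ
    (fun g => V fun j => ((g j).val : ℤ)) lam0 (fun z hz hsum => by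
      obtain ⟨v, hv0, hv⟩ := exists_torus_solution q V lam0 hiso.ge z hz hsum
      exact exists_fourier_kernel _ _ v hv0 z lam0 hv)
  intro n
  have h1 := congr_fun h fun j => (n j : ZMod (q j : ℕ))
  rw [Pi.zero_apply] at h1
  rw [← h1]
  exact periodic_eq_of_cast_eq q hV fun j => by simp

end
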